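/- For any bounded measurable function φ on X × X and any b ∈ B_n: E[1{(K¹, K²) ∈ I(b)} γ_n^N(1)² φ(ζ_n^{K_n¹}, ζ_n^{K_n²})] = [Π_{p=0}^n (1/N_p)^{b_p} (1 − 1/N_p)^{1−b_p}] μ_b(φ). -/

import Mathlib

open MeasureTheory ProbabilityTheory Filter
open scoped ENNReal NNReal Classical

noncomputable section

namespace PFVar

variable {X : Type*} [MeasurableSpace X]

/-- The unnormalized Feynman–Kac measures `γ_p`. -/
def gammaFK (M0 : Measure X) (M : ℕ → Kernel X X) (G : ℕ → X → ℝ) : ℕ → Measure X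
  | 0 => M0
  | p + 1 =>
      ((gammaFK M0 M G p).withDensity fun x => ENNReal.ofReal (G p x)).bind
        (fun x => M (p + 1) x)

/-- `γ_n(φ)`. -/
def gInt (M0 : Measure X) (M : ℕ → Kernel X X) (G : ℕ → X → ℝ) (n : ℕ) (φ : X → ℝ) : ℝ :=
  ∫ x, φ x ∂(gammaFK M0 M G n)

/-- `η_n(φ) = γ_n(φ)/γ_n(1)`. -/
def eInt (M0 : Measure X) (M : ℕ → Kernel X X) (G : ℕ → X → ℝ) (n : ℕ) (φ : X → ℝ) : ℝ :=
  gInt M0 M G n φ / gInt M0 M G n 1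

/-- Law of the path `(X_0,…,X_k)` of an inhomogeneous Markov chain with initial law `μ0` and
transitions `κ`, recorded as an element of `ℕ → Y` (coordinates beyond `k` are junk). -/
def markovPath {Y : Type*} [MeasurableSpace Y] (μ0 : Measure Y) (κ : ℕ → Y → Measure Y) :
    ℕ → Measure (ℕ → Y)
  | 0 => μ0.map fun y _ => y
  | k + 1 =>
      (markovPath μ0 κ k).bind fun ω =>
        (κ (k + 1) (ω k)).map fun y => Function.update ω (k + 1) y

/-- Categorical distribution on `{0,…,m−1} ⊆ ℕ` with weights `w`. -/
def cat (m : ℕ) (w : ℕ → ℝ) : Measure ℕ :=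
  (∑ j ∈ Finset.range m, ENNReal.ofReal (w j))⁻¹ •
    ∑ j ∈ Finset.range m, ENNReal.ofReal (w j) • Measure.dirac j

/-- Uniform distribution on `{0,…,m−1}`. -/
def unif (m : ℕ) : Measure ℕ := cat m fun _ => 1

/-- Extend a finite tuple to `ℕ` with junk values. -/
def padF {Y : Type*} [Nonempty Y] {m : ℕ} (f : Fin m → Y) : ℕ → Y := fun i =>
  if h : i < m then f ⟨i, h⟩ else Classical.arbitrary Y

/-- One resampling/mutation step of the particle filter: given the time-`p` configuration `z`,
the joint law of the ancestor indices `A_p` and the time-`p+1` particle configuration;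
each of the `Np (p+1)` new particles independently draws an ancestor from the categorical
distribution with weights `G p (z j)`, `j < Np p`, and then moves according to `M (p+1)`. -/
def pfStep [Nonempty X] (M : ℕ → Kernel X X) (G : ℕ → X → ℝ) (Np : ℕ → ℕ) (p : ℕ)
    (z : ℕ → X) : Measure ((ℕ → ℕ) × (ℕ → X)) :=
  (Measure.pi fun _ : Fin (Np (p + 1)) =>
      (cat (Np p) fun j => G p (z j)).bind fun a =>
        (M (p + 1) (z a)).map fun x => (a, x)).map fun f =>
    (padF fun i => (f i).1, padF fun i => (f i).2)

/-- The law of the particle system `(ζ, A)` run up to time `k`: the first component is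
`ζ : time → particle index → X`, the second is `A : time → particle index → ℕ`, where
`A p i` is the ancestor index of particle `i` of generation `p+1`. -/
def pfLaw [Nonempty X] (M0 : Measure X) (M : ℕ → Kernel X X) (G : ℕ → X → ℝ)
    (Np : ℕ → ℕ) : ℕ → Measure ((ℕ → ℕ → X) × (ℕ → ℕ → ℕ))
  | 0 =>
      (Measure.pi fun _ : Fin (Np 0) => M0).map fun f =>
        (fun p => if p = 0 then padF f else fun _ => Classical.arbitrary X, fun _ _ => 0)
  | k + 1 =>
      (pfLaw M0 M G Np k).bind fun ω =>
        (pfStep M G Np k (ω.1 k)).map fun az =>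
          (Function.update ω.1 (k + 1) az.2, Function.update ω.2 k az.1)

/-- Eve indices: `eve A 0 i = i` and `eve A (p+1) i = eve A p (A p i)`. -/
def eve (A : ℕ → ℕ → ℕ) : ℕ → ℕ → ℕ
  | 0 => fun i => i
  | p + 1 => fun i => eve A p (A p i)

/-- `η_n^N(φ)`. -/
def etaN (Np : ℕ → ℕ) (n : ℕ) (φ : X → ℝ) (ω : (ℕ → ℕ → X) × (ℕ → ℕ → ℕ)) : ℝ :=
  (Np n : ℝ)⁻¹ * ∑ i ∈ Finset.range (Np n), φ (ω.1 n i)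

/-- `γ_n^N(φ)`. -/
def gammaN (G : ℕ → X → ℝ) (Np : ℕ → ℕ) (n : ℕ) (φ : X → ℝ)
    (ω : (ℕ → ℕ → X) × (ℕ → ℕ → ℕ)) : ℝ :=
  (∏ p ∈ Finset.range n, etaN Np p (G p) ω) * etaN Np n φ ω

/-- The variance estimator `V_n^N(φ)`. -/
def Vest (Np : ℕ → ℕ) (n : ℕ) (φ : X → ℝ) (ω : (ℕ → ℕ → X) × (ℕ → ℕ → ℕ)) : ℝ :=
  etaN Np n φ ω ^ 2 -
    (∏ p ∈ Finset.range n, (Np p : ℝ) / ((Np p : ℝ) - 1)) *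
      ((Np n : ℝ) * ((Np n : ℝ) - 1))⁻¹ *
      ∑ i ∈ Finset.range (Np n), ∑ j ∈ Finset.range (Np n),
        if eve ω.2 n i ≠ eve ω.2 n j then φ (ω.1 n i) * φ (ω.1 n j) else 0

/-- Initial law of the doubled chain used to define `μ_b`. -/
def pairInit (M0 : Measure X) (b : ℕ → Bool) : Measure (X × X) :=
  if b 0 then M0.map fun x => (x, x) else M0.prod M0

/-- Transitions of the doubled chain used to define `μ_b`. -/
def pairKer (M : ℕ → Kernel X X) (b : ℕ → Bool) (p : ℕ) (q : X × X) : Measure (X × X) :=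
  if b p then (M p q.1).map fun y => (y, y) else (M p q.1).prod (M p q.2)

/-- `μ_b(φ) = E_b[φ(X_n, X_n') ∏_{p<n} G_p(X_p) G_p(X_p')]`. -/
def muB (M0 : Measure X) (M : ℕ → Kernel X X) (G : ℕ → X → ℝ) (n : ℕ) (b : ℕ → Bool)
    (φ : X × X → ℝ) : ℝ :=
  ∫ ω, φ (ω n) * ∏ p ∈ Finset.range n, G p (ω p).1 * G p (ω p).2
    ∂(markovPath (pairInit M0 b) (pairKer M b) n)

/-- `φ ⊗ φ`. -/
def tens (φ : X → ℝ) : X × X → ℝ := fun q => φ q.1 * φ q.2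

/-- The binary string `e_p`. -/
def eVec (p : ℕ) : ℕ → Bool := fun q => q == p

/-- The zero binary string `0_n`. -/
def zeroVec : ℕ → Bool := fun _ => false

/-- Extension of a finite binary string to `ℕ → Bool`. -/
def extB (n : ℕ) (b : Fin (n + 1) → Bool) : ℕ → Bool := fun p =>
  if h : p < n + 1 then b ⟨p, h⟩ else false

/-- `v_{p,n}(φ) = (μ_{e_p}(φ⊗φ) − μ_{0_n}(φ⊗φ)) / γ_n(1)²`. -/
def vpn (M0 : Measure X) (M : ℕ → Kernel X X) (G : ℕ → X → ℝ) (n p : ℕ) (φ : X → ℝ) : ℝ :=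
  (muB M0 M G n (eVec p) (tens φ) - muB M0 M G n zeroVec (tens φ)) / gInt M0 M G n 1 ^ 2

/-- `σ_n²(φ) = Σ_{p=0}^n c_p⁻¹ v_{p,n}(φ)`. -/
def sigma2 (M0 : Measure X) (M : ℕ → Kernel X X) (G : ℕ → X → ℝ) (c : ℕ → ℝ) (n : ℕ)
    (φ : X → ℝ) : ℝ :=
  ∑ p ∈ Finset.range (n + 1), (c p)⁻¹ * vpn M0 M G n p φ

/-- Particle numbers `N_p = ⌈c_p N⌉`. -/
def npart (c : ℕ → ℝ) (N : ℕ) (p : ℕ) : ℕ := ⌈c p * (N : ℝ)⌉₊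

/-- Backward tracing: `traceAux A n kn j = K_{n-j}` where `K_n = kn`, `K_p = A p (K_{p+1})`. -/
def traceAux (A : ℕ → ℕ → ℕ) (n kn : ℕ) : ℕ → ℕ
  | 0 => kn
  | j + 1 => A (n - (j + 1)) (traceAux A n kn j)

/-- The deterministic ancestral trace `K¹`: `trace A n kn p = K_p¹` given `K_n¹ = kn`. -/
def trace (A : ℕ → ℕ → ℕ) (n kn : ℕ) : ℕ → ℕ := fun p => traceAux A n kn (n - p)

/-- Conditional law of the broken-lineage trace `(K_0²,…,K_p²)` given `K_p² = v`
(entries above `p` are junk, to be overwritten). -/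
def k2Law (G : ℕ → X → ℝ) (Np : ℕ → ℕ) (ω : (ℕ → ℕ → X) × (ℕ → ℕ → ℕ)) (K1 : ℕ → ℕ) :
    ℕ → ℕ → Measure (ℕ → ℕ)
  | 0 => fun v => Measure.dirac fun q => if q = 0 then v else 0
  | p + 1 => fun v =>
      ((if v = K1 (p + 1) then cat (Np p) fun j => G p (ω.1 p j)
          else Measure.dirac (ω.2 p v)).bind fun w =>
        (k2Law G Np ω K1 p w).map fun f => Function.update f (p + 1) v)

/-- Conditional law of `(K¹, K²)` given the particle system `ω = (ζ, A)`. -/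
def kLaw (G : ℕ → X → ℝ) (Np : ℕ → ℕ) (n : ℕ) (ω : (ℕ → ℕ → X) × (ℕ → ℕ → ℕ)) :
    Measure ((ℕ → ℕ) × (ℕ → ℕ)) :=
  (unif (Np n)).bind fun k1n =>
    (unif (Np n)).bind fun k2n =>
      (k2Law G Np ω (trace ω.2 n k1n) n k2n).map fun k2 => (trace ω.2 n k1n, k2)

/-- Joint law of the particle system together with the tracing variables `(K¹, K²)`. -/
def pfkLaw [Nonempty X] (M0 : Measure X) (M : ℕ → Kernel X X) (G : ℕ → X → ℝ)
    (Np : ℕ → ℕ) (n : ℕ) :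
    Measure (((ℕ → ℕ → X) × (ℕ → ℕ → ℕ)) × ((ℕ → ℕ) × (ℕ → ℕ))) :=
  (pfLaw M0 M G Np n).bind fun ω => (kLaw G Np n ω).map fun k => (ω, k)

/-- `(k¹, k²) ∈ I(b)`. -/
def inI (Np : ℕ → ℕ) (n : ℕ) (b : ℕ → Bool) (k : (ℕ → ℕ) × (ℕ → ℕ)) : Prop :=
  ∀ p ≤ n, k.1 p < Np p ∧ k.2 p < Np p ∧ (k.1 p = k.2 p ↔ b p = true)

/-- The particle approximation `μ_b^N(φ)` (a function of the realization `ω = (ζ, A)`);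
the conditional expectation given `(A, ζ)` is the integral with respect to `kLaw`. -/
def muBN (G : ℕ → X → ℝ) (Np : ℕ → ℕ) (n : ℕ) (b : ℕ → Bool) (φ : X × X → ℝ)
    (ω : (ℕ → ℕ → X) × (ℕ → ℕ → ℕ)) : ℝ :=
  (∏ p ∈ Finset.range (n + 1),
      if b p then (Np p : ℝ) else (Np p : ℝ) / ((Np p : ℝ) - 1)) *
    gammaN G Np n 1 ω ^ 2 *
    ∫ k, (if inI Np n b k then (1 : ℝ) else 0) * φ (ω.1 n (k.1 n), ω.1 n (k.2 n))
      ∂(kLaw G Np n ω)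

/-- `v_{p,n}^N(φ)`. -/
def vpnN (G : ℕ → X → ℝ) (Np : ℕ → ℕ) (n p : ℕ) (φ : X → ℝ)
    (ω : (ℕ → ℕ → X) × (ℕ → ℕ → ℕ)) : ℝ :=
  (muBN G Np n (eVec p) (tens φ) ω - muBN G Np n zeroVec (tens φ) ω) / gammaN G Np n 1 ω ^ 2

/-- `v_n^N(φ) = Σ_{p=0}^n c_p⁻¹ v_{p,n}^N(φ)`. -/
def vnN (G : ℕ → X → ℝ) (Np : ℕ → ℕ) (c : ℕ → ℝ) (n : ℕ) (φ : X → ℝ)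
    (ω : (ℕ → ℕ → X) × (ℕ → ℕ → ℕ)) : ℝ :=
  ∑ p ∈ Finset.range (n + 1), (c p)⁻¹ * vpnN G Np n p φ ω

/-- `QAux M G n φ j = Q_{n-j,n}(φ)`. -/
def QAux (M : ℕ → Kernel X X) (G : ℕ → X → ℝ) (n : ℕ) (φ : X → ℝ) : ℕ → X → ℝ
  | 0 => φ
  | j + 1 => fun x => G (n - (j + 1)) x * ∫ y, QAux M G n φ j y ∂(M (n - j) x)

/-- `Q_{p,n}(φ)` where `Q_p(x, dx') = G_{p-1}(x) M_p(x, dx')`, `Q_{n,n} = Id`,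
`Q_{p,n} = Q_{p+1} ⋯ Q_n`. -/
def Qpn (M : ℕ → Kernel X X) (G : ℕ → X → ℝ) (n p : ℕ) (φ : X → ℝ) : X → ℝ :=
  QAux M G n φ (n - p)

/-- `φ̂ = G_n · φ`. -/
def hatf (G : ℕ → X → ℝ) (n : ℕ) (φ : X → ℝ) : X → ℝ := fun x => G n x * φ x

/-- `γ̂_n(φ) = γ_n(G_n φ)`. -/
def gHatInt (M0 : Measure X) (M : ℕ → Kernel X X) (G : ℕ → X → ℝ) (n : ℕ) (φ : X → ℝ) : ℝ :=
  gInt M0 M G n (hatf G n φ)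

/-- `η̂_n(φ) = γ̂_n(φ)/γ̂_n(1)`. -/
def eHatInt (M0 : Measure X) (M : ℕ → Kernel X X) (G : ℕ → X → ℝ) (n : ℕ) (φ : X → ℝ) : ℝ :=
  gHatInt M0 M G n φ / gHatInt M0 M G n 1

/-- `γ̂_n^N(φ) = γ_n^N(G_n φ)`. -/
def gammaHatN (G : ℕ → X → ℝ) (Np : ℕ → ℕ) (n : ℕ) (φ : X → ℝ)
    (ω : (ℕ → ℕ → X) × (ℕ → ℕ → ℕ)) : ℝ :=
  gammaN G Np n (hatf G n φ) ω

/-- `η̂_n^N(φ) = γ̂_n^N(φ)/γ̂_n^N(1)`. -/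
def etaHatN (G : ℕ → X → ℝ) (Np : ℕ → ℕ) (n : ℕ) (φ : X → ℝ)
    (ω : (ℕ → ℕ → X) × (ℕ → ℕ → ℕ)) : ℝ :=
  gammaHatN G Np n φ ω / gammaHatN G Np n 1 ω

/-- `v̂_{p,n}(φ) = v_{p,n}(φ̂)/η_n(G_n)²`. -/
def vpnHat (M0 : Measure X) (M : ℕ → Kernel X X) (G : ℕ → X → ℝ) (n p : ℕ) (φ : X → ℝ) : ℝ :=
  vpn M0 M G n p (hatf G n φ) / eInt M0 M G n (G n) ^ 2

/-- `σ̂_n²(φ) = Σ_{p=0}^n c_p⁻¹ v̂_{p,n}(φ)`. -/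
def sigma2Hat (M0 : Measure X) (M : ℕ → Kernel X X) (G : ℕ → X → ℝ) (c : ℕ → ℝ) (n : ℕ)
    (φ : X → ℝ) : ℝ :=
  ∑ p ∈ Finset.range (n + 1), (c p)⁻¹ * vpnHat M0 M G n p φ

/-- `V̂_n^N(φ) = V_n^N(φ̂)/η_n^N(G_n)²`. -/
def VestHat (G : ℕ → X → ℝ) (Np : ℕ → ℕ) (n : ℕ) (φ : X → ℝ)
    (ω : (ℕ → ℕ → X) × (ℕ → ℕ → ℕ)) : ℝ :=
  Vest Np n (hatf G n φ) ω / etaN Np n (G n) ω ^ 2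

/-- `v̂_{p,n}^N(φ) = v_{p,n}^N(φ̂)/η_n^N(G_n)²`. -/
def vpnHatN (G : ℕ → X → ℝ) (Np : ℕ → ℕ) (n p : ℕ) (φ : X → ℝ)
    (ω : (ℕ → ℕ → X) × (ℕ → ℕ → ℕ)) : ℝ :=
  vpnN G Np n p (hatf G n φ) ω / etaN Np n (G n) ω ^ 2

/-- `v̂_n^N(φ) = Σ_{p=0}^n c_p⁻¹ v̂_{p,n}^N(φ)`. -/
def vnHatN (G : ℕ → X → ℝ) (Np : ℕ → ℕ) (c : ℕ → ℝ) (n : ℕ) (φ : X → ℝ)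
    (ω : (ℕ → ℕ → X) × (ℕ → ℕ → ℕ)) : ℝ :=
  ∑ p ∈ Finset.range (n + 1), (c p)⁻¹ * vpnHatN G Np n p φ ω


open PFVar MeasureTheory ProbabilityTheory Filter

section MeasurableFamilies

variable {α β γ : Type*} [MeasurableSpace α] [MeasurableSpace β] [MeasurableSpace γ]

theorem measurable_bind_family {μ : α → Measure β} (hμ : Measurable μ)
    [∀ a, IsProbabilityMeasure (μ a)] {κ : α → β → Measure γ}
    (hκ : Measurable fun q : α × β => κ q.1 q.2) :
    Measurable fun a => (μ a).bind (κ a) := by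
  refine Measure.measurable_of_measurable_coe _ fun s hs => ?_
  have hsec : ∀ a, Measurable (κ a) := fun a => hκ.comp measurable_prodMk_left
  simp_rw [fun a => Measure.bind_apply hs (hsec a).aemeasurable]
  let K : Kernel α β := ⟨μ, hμ⟩
  have : IsMarkovKernel K := ⟨fun a => inferInstanceAs (IsProbabilityMeasure (μ a))⟩
  exact Measurable.lintegral_kernel_prod_right (κ := K) ((Measure.measurable_coe hs).comp hκ)

theorem measurable_map_family {μ : α → Measure β} (hμ : Measurable μ)
    [∀ a, IsProbabilityMeasure (μ a)] {f : α → β → γ}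
    (hf : Measurable fun q : α × β => f q.1 q.2) :
    Measurable fun a => (μ a).map (f a) := by
  have h : (fun a => (μ a).map (f a)) = fun a => (μ a).bind fun y => Measure.dirac (f a y) := by
    funext a
    exact (Measure.bind_dirac_eq_map (μ a) (hf.comp measurable_prodMk_left)).symm
  rw [h]
  exact measurable_bind_family hμ (Measure.measurable_dirac.comp hf)

theorem isProbabilityMeasure_bind {μ : Measure β} [IsProbabilityMeasure μ] {κ : β → Measure γ}
    (hκ : Measurable κ) [∀ b, IsProbabilityMeasure (κ b)] : IsProbabilityMeasure (μ.bind κ) :=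
  ⟨by simp [Measure.bind_apply MeasurableSet.univ hκ.aemeasurable]⟩

theorem measurable_pi_family {ι : Type*} [Fintype ι] {ν : α → Measure β} (hν : Measurable ν)
    [∀ a, IsProbabilityMeasure (ν a)] :
    Measurable fun a => Measure.pi fun _ : ι => ν a := by
  refine Measurable.measure_of_isPiSystem_of_isProbabilityMeasure
    (generateFrom_pi (ι := ι) (α := fun _ => β)).symm isPiSystem_pi ?_
  rintro _ ⟨t, ht, rfl⟩
  simp only [Measure.pi_pi]
  exact Finset.measurable_prod _ fun i _ =>
    (Measure.measurable_coe (ht i (Set.mem_univ i))).comp hν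

theorem lintegral_pi_eval {ι : Type*} [Fintype ι] (ν : Measure β) [IsProbabilityMeasure ν] (i : ι)
    {h : β → ℝ≥0∞} (hh : Measurable h) :
    ∫⁻ f, h (f i) ∂(Measure.pi fun _ : ι => ν) = ∫⁻ y, h y ∂ν :=
  (measurePreserving_eval (fun _ : ι => ν) i).lintegral_comp hh

theorem lintegral_pi_eval_pair {ι : Type*} [Fintype ι] (ν : Measure β) [IsProbabilityMeasure ν]
    {i j : ι} (hij : i ≠ j) {h : β → β → ℝ≥0∞} (hh : Measurable fun q : β × β => h q.1 q.2) :
    ∫⁻ f, h (f i) (f j) ∂(Measure.pi fun _ : ι => ν) = ∫⁻ x, ∫⁻ y, h x y ∂ν ∂ν := by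
  have hind : IndepFun (fun f : ι → β => f i) (fun f => f j) (Measure.pi fun _ : ι => ν) :=
    (iIndepFun_pi (μ := fun _ : ι => ν) (X := fun _ => id)
      (fun _ => aemeasurable_id)).indepFun hij
  have hmap := (indepFun_iff_map_prod_eq_prod_map_map (measurable_pi_apply i).aemeasurable
    (measurable_pi_apply j).aemeasurable).1 hind
  have e : ∀ k : ι, (Measure.pi fun _ : ι => ν).map (fun f => f k) = ν :=
    fun k => (measurePreserving_eval (fun _ : ι => ν) k).map_eq
  rw [e, e] at hmap
  rw [← lintegral_prod (fun q : β × β => h q.1 q.2) hh.aemeasurable, ← hmap,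
    lintegral_map hh ((measurable_pi_apply i).prodMk (measurable_pi_apply j))]

end MeasurableFamilies

section Categorical

def catWeight (m : ℕ) (w : ℕ → ℝ) (j : ℕ) : ℝ≥0∞ :=
  (∑ k ∈ Finset.range m, ENNReal.ofReal (w k))⁻¹ * ENNReal.ofReal (w j)

theorem lintegral_cat (m : ℕ) (w : ℕ → ℝ) (h : ℕ → ℝ≥0∞) :
    ∫⁻ a, h a ∂(cat m w) = ∑ j ∈ Finset.range m, catWeight m w j * h j := by
  simp only [cat, catWeight, lintegral_smul_measure, lintegral_finsetSum_measure, lintegral_dirac,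
    smul_eq_mul, Finset.mul_sum, mul_assoc]

theorem isProbabilityMeasure_cat {m : ℕ} (hm : 0 < m) {w : ℕ → ℝ} (hw : ∀ j, 0 < w j) :
    IsProbabilityMeasure (cat m w) := by
  refine ⟨?_⟩
  simp only [cat, Measure.smul_apply, Measure.finsetSum_apply, measure_univ, smul_eq_mul, mul_one]
  refine ENNReal.inv_mul_cancel ?_ ?_
  · exact fun h => (ENNReal.ofReal_pos.2 (hw 0)).ne'
      (Finset.sum_eq_zero_iff.1 h 0 (Finset.mem_range.2 hm))
  · simp

theorem measurable_catWeight {α : Type*} [MeasurableSpace α] (m : ℕ) {w : α → ℕ → ℝ}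
    (hw : ∀ j, Measurable fun a => w a j) (j : ℕ) : Measurable fun a => catWeight m (w a) j :=
  (Finset.measurable_sum _ fun k _ => (hw k).ennreal_ofReal).inv.mul (hw j).ennreal_ofReal

theorem measurable_cat {α : Type*} [MeasurableSpace α] (m : ℕ) {w : α → ℕ → ℝ}
    (hw : ∀ j, Measurable fun a => w a j) : Measurable fun a => cat m (w a) := by
  refine Measure.measurable_of_measurable_coe _ fun s hs => ?_
  have h : (fun a => cat m (w a) s) =
      fun a => ∑ j ∈ Finset.range m, catWeight m (w a) j * s.indicator 1 j := by
    funext a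
    rw [← lintegral_indicator_one hs, lintegral_cat]
  rw [h]
  exact Finset.measurable_sum _ fun j _ => (measurable_catWeight m hw j).mul_const _

end Categorical

section ParticleStep

theorem measurable_padF {Y : Type*} [MeasurableSpace Y] [Nonempty Y] (m : ℕ) :
    Measurable (padF : (Fin m → Y) → ℕ → Y) := by
  refine measurable_pi_lambda _ fun i => ?_
  unfold padF
  split_ifs with h
  · exact measurable_pi_apply _
  · exact measurable_const

theorem padF_of_lt {Y : Type*} [Nonempty Y] {m : ℕ} (f : Fin m → Y) {i : ℕ} (h : i < m) :
    padF f i = f ⟨i, h⟩ := dif_pos h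

/-- The law of the ancestor index and the location of a single new particle. -/
def offspringLaw (M : ℕ → Kernel X X) (G : ℕ → X → ℝ) (Np : ℕ → ℕ) (p : ℕ) (z : ℕ → X) :
    Measure (ℕ × X) :=
  (cat (Np p) fun j => G p (z j)).bind fun a => (M (p + 1) (z a)).map fun x => (a, x)

variable {M : ℕ → Kernel X X} {G : ℕ → X → ℝ} {Np : ℕ → ℕ} {p : ℕ}

theorem lintegral_offspringLaw (z : ℕ → X) {h : ℕ × X → ℝ≥0∞} (hh : Measurable h) :
    ∫⁻ y, h y ∂(offspringLaw M G Np p z) = ∑ a ∈ Finset.range (Np p),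
      catWeight (Np p) (fun j => G p (z j)) a * ∫⁻ x, h (a, x) ∂(M (p + 1) (z a)) := by
  rw [offspringLaw, Measure.lintegral_bind (measurable_of_countable _).aemeasurable hh.aemeasurable,
    lintegral_cat]
  exact Finset.sum_congr rfl fun a _ => by rw [lintegral_map hh measurable_prodMk_left]

theorem pfStep_eq [Nonempty X] (z : ℕ → X) : pfStep M G Np p z =
    (Measure.pi fun _ : Fin (Np (p + 1)) => offspringLaw M G Np p z).map fun f =>
      (padF fun i => (f i).1, padF fun i => (f i).2) := rfl

variable [∀ p, IsMarkovKernel (M p)]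

theorem isProbabilityMeasure_offspringLaw (hN : 0 < Np p) (hG : ∀ x, 0 < G p x) (z : ℕ → X) :
    IsProbabilityMeasure (offspringLaw M G Np p z) := by
  have := isProbabilityMeasure_cat hN (w := fun j => G p (z j)) fun j => hG _
  have : ∀ a : ℕ, IsProbabilityMeasure ((M (p + 1) (z a)).map fun x => (a, x)) :=
    fun a => Measure.isProbabilityMeasure_map measurable_prodMk_left.aemeasurable
  exact isProbabilityMeasure_bind (measurable_of_countable _)

theorem measurable_offspringLaw (hN : 0 < Np p) (hG : ∀ x, 0 < G p x) (hGm : Measurable (G p)) :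
    Measurable (offspringLaw M G Np p) := by
  have := fun z : ℕ → X => isProbabilityMeasure_cat hN (w := fun j => G p (z j)) fun j => hG _
  refine measurable_bind_family (μ := fun z : ℕ → X => cat (Np p) fun j => G p (z j))
    (measurable_cat _ fun j => hGm.comp (measurable_pi_apply j)) ?_
  refine measurable_from_prod_countable_left fun a => ?_
  exact measurable_map_family (μ := fun z : ℕ → X => M (p + 1) (z a)) (f := fun _ x => (a, x))
    ((M (p + 1)).measurable.comp (measurable_pi_apply a)) (measurable_const.prodMk measurable_snd)

variable [Nonempty X]

theorem measurable_padF_pair (m : ℕ) : Measurable fun f : Fin m → ℕ × X =>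
    ((padF fun i => (f i).1 : ℕ → ℕ), (padF fun i => (f i).2 : ℕ → X)) :=
  ((measurable_padF m).comp
    (measurable_pi_lambda _ fun i => (measurable_pi_apply i).fst)).prodMk
  ((measurable_padF m).comp (measurable_pi_lambda _ fun i => (measurable_pi_apply i).snd))

theorem isProbabilityMeasure_pfStep (hN : 0 < Np p) (hG : ∀ x, 0 < G p x) (z : ℕ → X) :
    IsProbabilityMeasure (pfStep M G Np p z) := by
  have := isProbabilityMeasure_offspringLaw (M := M) hN hG z
  rw [pfStep_eq]
  exact Measure.isProbabilityMeasure_map (measurable_padF_pair _).aemeasurable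

theorem measurable_pfStep (hN : 0 < Np p) (hG : ∀ x, 0 < G p x) (hGm : Measurable (G p)) :
    Measurable (pfStep M G Np p) := by
  have := isProbabilityMeasure_offspringLaw (M := M) hN hG
  exact (Measure.measurable_map _ (measurable_padF_pair _)).comp
    (measurable_pi_family (ν := offspringLaw M G Np p) (measurable_offspringLaw hN hG hGm))

theorem lintegral_pfStep_single (hN : 0 < Np p) (hG : ∀ x, 0 < G p x) (z : ℕ → X) {i : ℕ}
    (hi : i < Np (p + 1)) {h : ℕ → X → ℝ≥0∞} (hh : ∀ a, Measurable (h a)) :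
    ∫⁻ az, h (az.1 i) (az.2 i) ∂(pfStep M G Np p z) = ∑ a ∈ Finset.range (Np p),
      catWeight (Np p) (fun j => G p (z j)) a * ∫⁻ x, h a x ∂(M (p + 1) (z a)) := by
  have := isProbabilityMeasure_offspringLaw (M := M) hN hG z
  have hh' : Measurable fun q : ℕ × X => h q.1 q.2 := measurable_from_prod_countable_right hh
  have hpr : Measurable fun az : (ℕ → ℕ) × (ℕ → X) => (az.1 i, az.2 i) :=
    (measurable_fst.eval).prodMk (measurable_snd.eval)
  rw [pfStep_eq, lintegral_map (f := fun az : (ℕ → ℕ) × (ℕ → X) => h (az.1 i) (az.2 i))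
    (hh'.comp hpr) (measurable_padF_pair _)]
  simp_rw [padF_of_lt _ hi]
  rw [lintegral_pi_eval (offspringLaw M G Np p z) (⟨i, hi⟩ : Fin (Np (p + 1)))
    (h := fun q => h q.1 q.2) hh', lintegral_offspringLaw z hh']

theorem lintegral_pfStep_pair (hN : 0 < Np p) (hG : ∀ x, 0 < G p x) (z : ℕ → X) {i j : ℕ}
    (hi : i < Np (p + 1)) (hj : j < Np (p + 1)) (hij : i ≠ j) {h : ℕ → ℕ → X × X → ℝ≥0∞}
    (hh : ∀ a a', Measurable (h a a')) :
    ∫⁻ az, h (az.1 i) (az.1 j) (az.2 i, az.2 j) ∂(pfStep M G Np p z) =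
      ∑ a ∈ Finset.range (Np p), ∑ a' ∈ Finset.range (Np p),
        catWeight (Np p) (fun j => G p (z j)) a * catWeight (Np p) (fun j => G p (z j)) a' *
          ∫⁻ q, h a a' q ∂((M (p + 1) (z a)).prod (M (p + 1) (z a'))) := by
  have := isProbabilityMeasure_offspringLaw (M := M) hN hG z
  have hh' : Measurable fun q : (ℕ × X) × (ℕ × X) => h q.1.1 q.2.1 (q.1.2, q.2.2) := by
    have h0 : Measurable fun r : (ℕ × ℕ) × (X × X) => h r.1.1 r.1.2 r.2 :=
      measurable_from_prod_countable_right fun a => hh a.1 a.2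
    exact h0.comp (((measurable_fst.comp measurable_fst).prodMk
      (measurable_fst.comp measurable_snd)).prodMk
      ((measurable_snd.comp measurable_fst).prodMk (measurable_snd.comp measurable_snd)))
  have hpr : Measurable fun az : (ℕ → ℕ) × (ℕ → X) => ((az.1 i, az.2 i), (az.1 j, az.2 j)) :=
    ((measurable_fst.eval).prodMk (measurable_snd.eval)).prodMk
      ((measurable_fst.eval).prodMk (measurable_snd.eval))
  rw [pfStep_eq, lintegral_map (f := fun az : (ℕ → ℕ) × (ℕ → X) =>
    h (az.1 i) (az.1 j) (az.2 i, az.2 j)) (hh'.comp hpr) (measurable_padF_pair _)]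
  simp_rw [padF_of_lt _ hi, padF_of_lt _ hj]
  have hne : (⟨i, hi⟩ : Fin (Np (p + 1))) ≠ ⟨j, hj⟩ := fun e => hij (Fin.mk.inj_iff.1 e)
  rw [lintegral_pi_eval_pair (offspringLaw M G Np p z) hne
    (h := fun q r => h q.1 r.1 (q.2, r.2)) hh', lintegral_offspringLaw z hh'.lintegral_prod_right']
  refine Finset.sum_congr rfl fun a _ => ?_
  have e : ∀ x, ∫⁻ r, h a r.1 (x, r.2) ∂(offspringLaw M G Np p z) =
      ∑ a' ∈ Finset.range (Np p), catWeight (Np p) (fun j => G p (z j)) a' *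
        ∫⁻ y, h a a' (x, y) ∂(M (p + 1) (z a')) := fun x =>
    lintegral_offspringLaw z (h := fun r => h a r.1 (x, r.2))
      (hh'.comp (measurable_prodMk_left (x := (a, x))))
  have hm : ∀ a', Measurable fun x => ∫⁻ y, h a a' (x, y) ∂(M (p + 1) (z a')) :=
    fun a' => (hh a a').lintegral_prod_right'
  simp_rw [e]
  rw [lintegral_finsetSum _ fun a' _ => (hm a').const_mul _, Finset.mul_sum]
  refine Finset.sum_congr rfl fun a' _ => ?_
  rw [lintegral_const_mul _ (hm a'), lintegral_prod _ (hh a a').aemeasurable, mul_assoc]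

end ParticleStep

section PairWeight

theorem measurable_comp_nat {α β : Type*} [MeasurableSpace α] [MeasurableSpace β]
    {g : ℕ → α → β} (hg : ∀ i, Measurable (g i)) {I : α → ℕ} (hI : Measurable I) :
    Measurable fun a => g (I a) a :=
  (measurable_from_prod_countable_right (f := fun q : ℕ × α => g q.1 q.2) hg).comp
    (hI.prodMk measurable_id)

theorem measurable_comp_nat_pair {α β : Type*} [MeasurableSpace α] [MeasurableSpace β]
    {g : ℕ → ℕ → α → β} (hg : ∀ i j, Measurable (g i j)) {I J : α → ℕ} (hI : Measurable I)
    (hJ : Measurable J) : Measurable fun a => g (I a) (J a) a :=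
  measurable_comp_nat (fun i => measurable_comp_nat (hg i) hJ) hI

/-- The conditional probability, given the particle system `ω`, that the two traces started from
`K_p¹ = i` and `K_p² = j` coincide exactly at the times `q ≤ p` with `b q = true`. -/
def pairWeight (G : ℕ → X → ℝ) (Np : ℕ → ℕ) (b : ℕ → Bool) :
    ℕ → (ℕ → ℕ → X) × (ℕ → ℕ → ℕ) → ℕ → ℕ → ℝ≥0∞
  | 0 => fun _ i j => if i < Np 0 ∧ j < Np 0 ∧ (i = j ↔ b 0 = true) then 1 else 0
  | p + 1 => fun ω i j =>
      if i < Np (p + 1) ∧ j < Np (p + 1) ∧ (i = j ↔ b (p + 1) = true) then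
        if j = i then
          ∑ w ∈ Finset.range (Np p), catWeight (Np p) (fun l => G p (ω.1 p l)) w *
            pairWeight G Np b p ω (ω.2 p i) w
        else pairWeight G Np b p ω (ω.2 p i) (ω.2 p j)
      else 0

/-- The square of `γ_p^N(1)`. -/
def normSq (G : ℕ → X → ℝ) (Np : ℕ → ℕ) (p : ℕ) (ω : (ℕ → ℕ → X) × (ℕ → ℕ → ℕ)) : ℝ≥0∞ :=
  ∏ q ∈ Finset.range p, ENNReal.ofReal (etaN Np q (G q) ω) ^ 2

variable {M0 : Measure X} {M : ℕ → Kernel X X} {G : ℕ → X → ℝ} {Np : ℕ → ℕ} {b : ℕ → Bool}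

theorem measurable_particle (p i : ℕ) :
    Measurable fun ω : (ℕ → ℕ → X) × (ℕ → ℕ → ℕ) => ω.1 p i :=
  measurable_fst.eval.eval

theorem measurable_ancestor (p i : ℕ) :
    Measurable fun ω : (ℕ → ℕ → X) × (ℕ → ℕ → ℕ) => ω.2 p i :=
  measurable_snd.eval.eval

theorem measurable_pairWeight {p : ℕ} (hGm : ∀ q < p, Measurable (G q)) (i j : ℕ) :
    Measurable fun ω => pairWeight G Np b p ω i j := by
  induction p generalizing i j with
  | zero => exact measurable_const
  | succ p ih =>
    have ih' := ih fun q hq => hGm q (hq.trans p.lt_succ_self)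
    simp only [pairWeight]
    split_ifs
    · refine Finset.measurable_sum _ fun w _ => (measurable_catWeight _ (fun l =>
        (hGm p p.lt_succ_self).comp (measurable_particle p l)) w).mul ?_
      exact measurable_comp_nat (fun i => ih' i w) (measurable_ancestor p i)
    · exact measurable_comp_nat_pair ih' (measurable_ancestor p i) (measurable_ancestor p j)
    · exact measurable_const

theorem pairWeight_congr {Y : Type*} {G : ℕ → Y → ℝ} {p : ℕ}
    {ω ω' : (ℕ → ℕ → Y) × (ℕ → ℕ → ℕ)}
    (h1 : ∀ q < p, ω.1 q = ω'.1 q) (h2 : ∀ q < p, ω.2 q = ω'.2 q) (i j : ℕ) :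
    pairWeight G Np b p ω i j = pairWeight G Np b p ω' i j := by
  induction p generalizing i j with
  | zero => rfl
  | succ p ih =>
    simp only [pairWeight, h1 p p.lt_succ_self, h2 p p.lt_succ_self,
      ih (fun q hq => h1 q (hq.trans p.lt_succ_self)) fun q hq => h2 q (hq.trans p.lt_succ_self)]

theorem measurable_etaN {p : ℕ} (hGm : Measurable (G p)) :
    Measurable (etaN Np p (G p)) :=
  (Finset.measurable_sum _ fun i _ => hGm.comp (measurable_particle p i)).const_mul _

theorem measurable_normSq {p : ℕ} (hGm : ∀ q < p, Measurable (G q)) :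
    Measurable (normSq G Np p) :=
  Finset.measurable_prod _ fun q hq =>
    (measurable_etaN (hGm q (Finset.mem_range.1 hq))).ennreal_ofReal.pow_const _

theorem normSq_congr {Y : Type*} {G : ℕ → Y → ℝ} {p : ℕ} {ω ω' : (ℕ → ℕ → Y) × (ℕ → ℕ → ℕ)}
    (h1 : ∀ q < p, ω.1 q = ω'.1 q) : normSq G Np p ω = normSq G Np p ω' :=
  Finset.prod_congr rfl fun q hq => by simp only [etaN, h1 q (Finset.mem_range.1 hq)]

theorem ofReal_etaN_mul_catWeight {Y : Type*} {G : ℕ → Y → ℝ} {p : ℕ} (hN : 0 < Np p)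
    (hG : ∀ x, 0 < G p x) (ω : (ℕ → ℕ → Y) × (ℕ → ℕ → ℕ)) (a : ℕ) :
    ENNReal.ofReal (etaN Np p (G p) ω) * catWeight (Np p) (fun j => G p (ω.1 p j)) a =
      (Np p : ℝ≥0∞)⁻¹ * ENNReal.ofReal (G p (ω.1 p a)) := by
  have hS : ∑ k ∈ Finset.range (Np p), ENNReal.ofReal (G p (ω.1 p k)) ≠ 0 := fun h =>
    (ENNReal.ofReal_pos.2 (hG _)).ne' (Finset.sum_eq_zero_iff.1 h 0 (Finset.mem_range.2 hN))
  have hS' : ∑ k ∈ Finset.range (Np p), ENNReal.ofReal (G p (ω.1 p k)) ≠ ∞ := by simp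
  rw [etaN, catWeight, ENNReal.ofReal_mul (by positivity),
    ENNReal.ofReal_inv_of_pos (by exact_mod_cast hN), ENNReal.ofReal_natCast,
    ENNReal.ofReal_sum_of_nonneg fun i _ => (hG _).le, mul_assoc, ← mul_assoc _ _⁻¹,
    ENNReal.mul_inv_cancel hS hS', one_mul]

theorem sum_sum_ite_eq_iff {m : ℕ} (hm : 0 < m) (β : Bool) :
    (m : ℝ≥0∞)⁻¹ ^ 2 * ∑ i ∈ Finset.range m, ∑ j ∈ Finset.range m,
      (if (i = j ↔ β = true) then (1 : ℝ≥0∞) else 0) =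
      if β then (m : ℝ≥0∞)⁻¹ else 1 - (m : ℝ≥0∞)⁻¹ := by
  have hm0 : (m : ℝ≥0∞) ≠ 0 := by exact_mod_cast hm.ne'
  have hmt : (m : ℝ≥0∞) ≠ ∞ := ENNReal.natCast_ne_top m
  cases β
  · have h : ∀ i ∈ Finset.range m, ∑ j ∈ Finset.range m,
        (if (i = j ↔ false = true) then (1 : ℝ≥0∞) else 0) = m - 1 := by
      intro i hi
      have hc : (Finset.range m).filter (fun j => i ≠ j) = (Finset.range m).erase i := by
        ext j; simp [and_comm, eq_comm]
      simp only [Bool.false_eq_true, iff_false, Finset.sum_boole]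
      rw [hc, Finset.card_erase_of_mem hi, Finset.card_range, ENNReal.natCast_sub, Nat.cast_one]
    rw [Finset.sum_congr rfl h, Finset.sum_const, Finset.card_range, nsmul_eq_mul, sq, mul_assoc,
      ← mul_assoc _ (m : ℝ≥0∞), ENNReal.inv_mul_cancel hm0 hmt, one_mul,
      ENNReal.mul_sub fun _ _ => ENNReal.inv_ne_top.2 hm0, ENNReal.inv_mul_cancel hm0 hmt]
    simp
  · have h : ∀ i ∈ Finset.range m, ∑ j ∈ Finset.range m,
        (if (i = j ↔ true = true) then (1 : ℝ≥0∞) else 0) = 1 := by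
      intro i hi
      simp [Finset.mem_range.1 hi]
    rw [Finset.sum_congr rfl h, Finset.sum_const, Finset.card_range, nsmul_eq_mul, sq, mul_assoc,
      mul_one, ENNReal.inv_mul_cancel hm0 hmt]
    simp

section Doubled

variable [∀ p, IsMarkovKernel (M p)]

theorem isProbabilityMeasure_pairKer (p : ℕ) (q : X × X) :
    IsProbabilityMeasure (pairKer M b p q) := by
  unfold pairKer
  split_ifs
  · exact Measure.isProbabilityMeasure_map (measurable_id.prodMk measurable_id).aemeasurable
  · infer_instance

theorem measurable_pairKer (p : ℕ) : Measurable (pairKer M b p) := by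
  unfold pairKer
  split_ifs
  · exact measurable_map_family (μ := fun q : X × X => M p q.1) (f := fun _ y => (y, y))
      ((M p).measurable.comp measurable_fst) (measurable_snd.prodMk measurable_snd)
  · have h : (fun q : X × X => (M p q.1).prod (M p q.2)) = ⇑(M p ∥ₖ M p) := by
      funext q
      exact (Kernel.parallelComp_apply (M p) (M p) q).symm
    rw [h]
    exact (M p ∥ₖ M p).measurable

theorem lintegral_markovPath_succ (k : ℕ) {h : (ℕ → X × X) → ℝ≥0∞} (hh : Measurable h) :
    ∫⁻ ω, h ω ∂(markovPath (pairInit M0 b) (pairKer M b) (k + 1)) =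
      ∫⁻ ω, ∫⁻ q, h (Function.update ω (k + 1) q) ∂(pairKer M b (k + 1) (ω k))
        ∂(markovPath (pairInit M0 b) (pairKer M b) k) := by
  have hu : Measurable fun r : (ℕ → X × X) × (X × X) => Function.update r.1 (k + 1) r.2 :=
    measurable_update'
  have := fun ω : ℕ → X × X => isProbabilityMeasure_pairKer (M := M) (b := b) (k + 1) (ω k)
  rw [markovPath, Measure.lintegral_bind (measurable_map_family
    (μ := fun ω : ℕ → X × X => pairKer M b (k + 1) (ω k))
    (f := fun ω y => Function.update ω (k + 1) y)
    ((measurable_pairKer (k + 1)).comp (measurable_pi_apply k)) hu).aemeasurable hh.aemeasurable]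
  refine lintegral_congr fun ω => ?_
  exact lintegral_map hh (measurable_update ω)

/-- The product of the potentials along the doubled path. -/
def pathPotential (G : ℕ → X → ℝ) (k : ℕ) (ω : ℕ → X × X) : ℝ≥0∞ :=
  ∏ p ∈ Finset.range k, ENNReal.ofReal (G p (ω p).1) * ENNReal.ofReal (G p (ω p).2)

theorem measurable_pathPotential {k : ℕ} (hGm : ∀ q < k, Measurable (G q)) :
    Measurable (pathPotential G k) :=
  Finset.measurable_prod _ fun q hq =>
    ((hGm q (Finset.mem_range.1 hq)).comp (measurable_pi_apply q).fst).ennreal_ofReal.mul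
      ((hGm q (Finset.mem_range.1 hq)).comp (measurable_pi_apply q).snd).ennreal_ofReal

theorem measurable_lintegral_pairKer (p : ℕ) {F : X × X → ℝ≥0∞} (hF : Measurable F) :
    Measurable fun q => ∫⁻ r, F r ∂(pairKer M b p q) :=
  (Measure.measurable_lintegral hF).comp (measurable_pairKer p)

theorem lintegral_markovPath_pathPotential_succ {k : ℕ} (hGm : ∀ q < k + 1, Measurable (G q))
    {F : X × X → ℝ≥0∞} (hF : Measurable F) :
    ∫⁻ ω, F (ω (k + 1)) * pathPotential G (k + 1) ω
        ∂(markovPath (pairInit M0 b) (pairKer M b) (k + 1)) =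
      ∫⁻ ω, ((∫⁻ r, F r ∂(pairKer M b (k + 1) (ω k))) *
          (ENNReal.ofReal (G k (ω k).1) * ENNReal.ofReal (G k (ω k).2))) * pathPotential G k ω
        ∂(markovPath (pairInit M0 b) (pairKer M b) k) := by
  rw [lintegral_markovPath_succ k (h := fun ω => F (ω (k + 1)) * pathPotential G (k + 1) ω)
    ((hF.comp (measurable_pi_apply _)).mul (measurable_pathPotential hGm))]
  refine lintegral_congr fun ω => ?_
  have e : ∀ q, pathPotential G (k + 1) (Function.update ω (k + 1) q) =
      pathPotential G (k + 1) ω := fun q => Finset.prod_congr rfl fun p hp => by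
    rw [Function.update_of_ne (Finset.mem_range.1 hp).ne]
  simp_rw [e, Function.update_self]
  rw [lintegral_mul_const _ hF, pathPotential, Finset.prod_range_succ, ← pathPotential]
  ring

end Doubled

end PairWeight

section ParticleSystem

variable {M0 : Measure X} {M : ℕ → Kernel X X} {G : ℕ → X → ℝ} {Np : ℕ → ℕ} {b : ℕ → Bool}

theorem measurable_updateSystem (k : ℕ) :
    Measurable fun r : ((ℕ → ℕ → X) × (ℕ → ℕ → ℕ)) × ((ℕ → ℕ) × (ℕ → X)) =>
      (Function.update r.1.1 (k + 1) r.2.2, Function.update r.1.2 k r.2.1) := by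
  have h1 : Measurable fun r : (ℕ → ℕ → X) × (ℕ → X) => Function.update r.1 (k + 1) r.2 :=
    measurable_update'
  have h2 : Measurable fun r : (ℕ → ℕ → ℕ) × (ℕ → ℕ) => Function.update r.1 k r.2 :=
    measurable_update'
  exact (h1.comp ((measurable_fst.comp measurable_fst).prodMk
    (measurable_snd.comp measurable_snd))).prodMk
      (h2.comp ((measurable_snd.comp measurable_fst).prodMk (measurable_fst.comp measurable_snd)))

theorem lintegral_pfLaw_zero_pairWeight [Nonempty X] [IsProbabilityMeasure M0]
    (hN : 0 < Np 0) {F : X × X → ℝ≥0∞} (hF : Measurable F) :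
    ∫⁻ ω, (Np 0 : ℝ≥0∞)⁻¹ ^ 2 * ∑ i ∈ Finset.range (Np 0), ∑ j ∈ Finset.range (Np 0),
        pairWeight G Np b 0 ω i j * F (ω.1 0 i, ω.1 0 j) ∂(pfLaw M0 M G Np 0) =
      (if b 0 then (Np 0 : ℝ≥0∞)⁻¹ else 1 - (Np 0 : ℝ≥0∞)⁻¹) * ∫⁻ q, F q ∂(pairInit M0 b) := by
  have hFm : ∀ i j, Measurable fun ω : (ℕ → ℕ → X) × (ℕ → ℕ → ℕ) => F (ω.1 0 i, ω.1 0 j) :=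
    fun i j => hF.comp ((measurable_particle 0 i).prodMk (measurable_particle 0 j))
  have hterm : ∀ i ∈ Finset.range (Np 0), ∀ j ∈ Finset.range (Np 0),
      ∫⁻ ω, pairWeight G Np b 0 ω i j * F (ω.1 0 i, ω.1 0 j) ∂(pfLaw M0 M G Np 0) =
        (if (i = j ↔ b 0 = true) then 1 else 0) * ∫⁻ q, F q ∂(pairInit M0 b) := by
    intro i hi j hj
    rw [Finset.mem_range] at hi hj
    have hinit : Measurable fun f : Fin (Np 0) → X =>
        ((fun p => if p = 0 then padF f else fun _ => Classical.arbitrary X, fun _ _ => 0) :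
          (ℕ → ℕ → X) × (ℕ → ℕ → ℕ)) := by
      refine (measurable_pi_lambda _ fun p => ?_).prodMk measurable_const
      split_ifs
      · exact measurable_padF _
      · exact measurable_const
    simp only [pairWeight, hi, hj, true_and]
    rw [lintegral_const_mul _ (hFm i j), pfLaw, lintegral_map (hFm i j) hinit]
    simp only [if_true, padF_of_lt _ hi, padF_of_lt _ hj]
    split_ifs with hb
    swap
    · simp
    rw [one_mul, one_mul]
    by_cases hij : i = j
    · subst hij
      have hd : Measurable fun x : X => (x, x) := measurable_id.prodMk measurable_id
      rw [lintegral_pi_eval M0 (⟨i, hi⟩ : Fin (Np 0)) (h := fun x => F (x, x)) (hF.comp hd),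
        pairInit, if_pos (hb.1 rfl), lintegral_map hF hd]
    · have hne : (⟨i, hi⟩ : Fin (Np 0)) ≠ ⟨j, hj⟩ := fun e => hij (Fin.mk.inj_iff.1 e)
      rw [lintegral_pi_eval_pair M0 hne (h := fun x y => F (x, y)) hF, pairInit,
        if_neg fun h => hij (hb.2 h), lintegral_prod _ hF.aemeasurable]
  have hm : ∀ i j, Measurable fun ω : (ℕ → ℕ → X) × (ℕ → ℕ → ℕ) =>
      pairWeight G Np b 0 ω i j * F (ω.1 0 i, ω.1 0 j) := fun i j =>
    (measurable_pairWeight (fun q hq => absurd hq q.not_lt_zero) i j).mul (hFm i j)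
  rw [lintegral_const_mul _ (Finset.measurable_sum _ fun i _ => Finset.measurable_sum _ fun j _ =>
      hm i j), lintegral_finsetSum _ fun i _ => Finset.measurable_sum _ fun j _ => hm i j,
    ← sum_sum_ite_eq_iff hN, mul_assoc, Finset.sum_mul]
  congr 1
  refine Finset.sum_congr rfl fun i hi => ?_
  rw [lintegral_finsetSum _ fun j _ => hm i j, Finset.sum_mul]
  exact Finset.sum_congr rfl fun j hj => hterm i hi j hj

variable [∀ p, IsMarkovKernel (M p)] [Nonempty X]

theorem lintegral_pfStep_pairWeight_succ {k : ℕ} (hN : 0 < Np k)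
    (hG : ∀ x, 0 < G k x) {F : X × X → ℝ≥0∞} (hF : Measurable F)
    (ω : (ℕ → ℕ → X) × (ℕ → ℕ → ℕ)) {i j : ℕ} (hi : i < Np (k + 1)) (hj : j < Np (k + 1)) :
    ∫⁻ az, pairWeight G Np b (k + 1)
        (Function.update ω.1 (k + 1) az.2, Function.update ω.2 k az.1) i j *
          F (az.2 i, az.2 j) ∂(pfStep M G Np k (ω.1 k)) =
      (if (i = j ↔ b (k + 1) = true) then 1 else 0) *
        ∑ a ∈ Finset.range (Np k), ∑ a' ∈ Finset.range (Np k),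
          catWeight (Np k) (fun l => G k (ω.1 k l)) a *
            catWeight (Np k) (fun l => G k (ω.1 k l)) a' *
              (pairWeight G Np b k ω a a' *
                ∫⁻ q, F q ∂(pairKer M b (k + 1) (ω.1 k a, ω.1 k a'))) := by
  have hW : ∀ (az : (ℕ → ℕ) × (ℕ → X)) i j, pairWeight G Np b k
      (Function.update ω.1 (k + 1) az.2, Function.update ω.2 k az.1) i j =
        pairWeight G Np b k ω i j := fun az i j => pairWeight_congr
    (fun q hq => Function.update_of_ne (hq.trans k.lt_succ_self).ne _ _)
    (fun q hq => Function.update_of_ne hq.ne _ _) i j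
  by_cases hb : (i = j ↔ b (k + 1) = true)
  swap
  · simp [pairWeight, hb]
  simp only [pairWeight, hW, hi, hj, hb, true_and, if_true, one_mul, Function.update_self,
    Function.update_of_ne k.lt_succ_self.ne]
  by_cases hij : i = j
  · subst hij
    have hbt : b (k + 1) = true := hb.1 rfl
    have hd : Measurable fun x : X => (x, x) := measurable_id.prodMk measurable_id
    simp only [if_true]
    rw [lintegral_pfStep_single hN hG (ω.1 k) hi (h := fun a x =>
      (∑ w ∈ Finset.range (Np k), catWeight (Np k) (fun l => G k (ω.1 k l)) w *
        pairWeight G Np b k ω a w) * F (x, x)) fun a => (hF.comp hd).const_mul _]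
    refine Finset.sum_congr rfl fun a _ => ?_
    rw [lintegral_const_mul (f := fun x => F (x, x)) _ (hF.comp hd), Finset.sum_mul, Finset.mul_sum]
    refine Finset.sum_congr rfl fun a' _ => ?_
    rw [pairKer, if_pos hbt, lintegral_map hF hd]
    ring
  · have hbf : ¬ b (k + 1) = true := fun h => hij (hb.2 h)
    simp only [if_neg (Ne.symm hij)]
    rw [lintegral_pfStep_pair hN hG (ω.1 k) hi hj hij
      (h := fun a a' q => pairWeight G Np b k ω a a' * F q) fun a a' => hF.const_mul _]
    refine Finset.sum_congr rfl fun a _ => Finset.sum_congr rfl fun a' _ => ?_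
    rw [lintegral_const_mul _ hF, pairKer, if_neg hbf]

theorem lintegral_pfLaw_succ {k : ℕ} (hN : 0 < Np k) (hG : ∀ x, 0 < G k x)
    (hGm : Measurable (G k)) {h : (ℕ → ℕ → X) × (ℕ → ℕ → ℕ) → ℝ≥0∞} (hh : Measurable h) :
    ∫⁻ ω, h ω ∂(pfLaw M0 M G Np (k + 1)) =
      ∫⁻ ω, ∫⁻ az, h (Function.update ω.1 (k + 1) az.2, Function.update ω.2 k az.1)
        ∂(pfStep M G Np k (ω.1 k)) ∂(pfLaw M0 M G Np k) := by
  have := fun ω : (ℕ → ℕ → X) × (ℕ → ℕ → ℕ) => isProbabilityMeasure_pfStep (M := M) hN hG (ω.1 k)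
  rw [pfLaw, Measure.lintegral_bind (measurable_map_family
    (μ := fun ω : (ℕ → ℕ → X) × (ℕ → ℕ → ℕ) => pfStep M G Np k (ω.1 k))
    (f := fun ω az => (Function.update ω.1 (k + 1) az.2, Function.update ω.2 k az.1))
    ((measurable_pfStep hN hG hGm).comp measurable_fst.eval)
    (measurable_updateSystem k)).aemeasurable hh.aemeasurable]
  refine lintegral_congr fun ω => ?_
  exact lintegral_map hh ((measurable_updateSystem k).comp measurable_prodMk_left)

theorem lintegral_pfLaw_pairWeight [IsProbabilityMeasure M0] {k : ℕ} (hN : ∀ p ≤ k, 0 < Np p)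
    (hG : ∀ p < k, ∀ x, 0 < G p x) (hGm : ∀ p < k, Measurable (G p))
    {F : X × X → ℝ≥0∞} (hF : Measurable F) :
    ∫⁻ ω, normSq G Np k ω * ((Np k : ℝ≥0∞)⁻¹ ^ 2 * ∑ i ∈ Finset.range (Np k),
        ∑ j ∈ Finset.range (Np k), pairWeight G Np b k ω i j * F (ω.1 k i, ω.1 k j))
        ∂(pfLaw M0 M G Np k) =
      (∏ p ∈ Finset.range (k + 1), if b p then (Np p : ℝ≥0∞)⁻¹ else 1 - (Np p : ℝ≥0∞)⁻¹) *
        ∫⁻ ω, F (ω k) * pathPotential G k ω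
          ∂(markovPath (pairInit M0 b) (pairKer M b) k) := by
  induction k generalizing F with
  | zero =>
    simp only [normSq, Finset.range_zero, Finset.prod_empty, one_mul, zero_add,
      Finset.prod_range_one, pathPotential, mul_one]
    rw [lintegral_pfLaw_zero_pairWeight (hN 0 le_rfl) hF, markovPath,
      lintegral_map (f := fun ω : ℕ → X × X => F (ω 0)) (g := fun y _ => y)
        (hF.comp (measurable_pi_apply 0)) (measurable_pi_lambda _ fun _ => measurable_id)]
  | succ k ih =>
    have hk := k.lt_succ_self
    have hFm : ∀ i j, Measurable fun ω : (ℕ → ℕ → X) × (ℕ → ℕ → ℕ) =>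
        F (ω.1 (k + 1) i, ω.1 (k + 1) j) :=
      fun i j => hF.comp ((measurable_particle _ i).prodMk (measurable_particle _ j))
    have hm : ∀ i j, Measurable fun ω : (ℕ → ℕ → X) × (ℕ → ℕ → ℕ) =>
        pairWeight G Np b (k + 1) ω i j * F (ω.1 (k + 1) i, ω.1 (k + 1) j) := fun i j =>
      (measurable_pairWeight hGm i j).mul (hFm i j)
    have hm' := Finset.measurable_sum (Finset.range (Np (k + 1))) fun i _ =>
      Finset.measurable_sum (Finset.range (Np (k + 1))) fun j _ => hm i j
    rw [lintegral_pfLaw_succ (hN k hk.le) (hG k hk) (hGm k hk)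
      (h := fun ω => normSq G Np (k + 1) ω * ((Np (k + 1) : ℝ≥0∞)⁻¹ ^ 2 *
        ∑ i ∈ Finset.range (Np (k + 1)), ∑ j ∈ Finset.range (Np (k + 1)),
          pairWeight G Np b (k + 1) ω i j * F (ω.1 (k + 1) i, ω.1 (k + 1) j)))
      ((measurable_normSq hGm).mul (hm'.const_mul _)),
      lintegral_markovPath_pathPotential_succ hGm hF, Finset.prod_range_succ, mul_right_comm]
    have hF' : Measurable fun q : X × X => (∫⁻ r, F r ∂(pairKer M b (k + 1) q)) *
        (ENNReal.ofReal (G k q.1) * ENNReal.ofReal (G k q.2)) :=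
      (measurable_lintegral_pairKer (k + 1) hF).mul
        (((hGm k hk).comp measurable_fst).ennreal_ofReal.mul
          ((hGm k hk).comp measurable_snd).ennreal_ofReal)
    have hmk : ∀ i j, Measurable fun ω : (ℕ → ℕ → X) × (ℕ → ℕ → ℕ) =>
        pairWeight G Np b k ω i j * ((∫⁻ r, F r ∂(pairKer M b (k + 1) (ω.1 k i, ω.1 k j))) *
          (ENNReal.ofReal (G k (ω.1 k i)) * ENNReal.ofReal (G k (ω.1 k j)))) := fun i j =>
      (measurable_pairWeight (fun p hp => hGm p (hp.trans hk)) i j).mul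
        (hF'.comp ((measurable_particle _ i).prodMk (measurable_particle _ j)))
    rw [← ih (fun p hp => hN p (hp.trans hk.le)) (fun p hp => hG p (hp.trans hk))
      (fun p hp => hGm p (hp.trans hk)) hF']
    refine Eq.trans ?_ (lintegral_mul_const _
      ((measurable_normSq fun p hp => hGm p (hp.trans hk)).mul
        ((Finset.measurable_sum _ fun i _ => Finset.measurable_sum _ fun j _ =>
          hmk i j).const_mul _)))
    refine lintegral_congr fun ω => ?_
    have hnorm : ∀ az : (ℕ → ℕ) × (ℕ → X), normSq G Np (k + 1)
        (Function.update ω.1 (k + 1) az.2, Function.update ω.2 k az.1) = normSq G Np (k + 1) ω :=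
      fun az => normSq_congr fun q hq => Function.update_of_ne hq.ne _ _
    have hu : Measurable fun az : (ℕ → ℕ) × (ℕ → X) =>
        (Function.update ω.1 (k + 1) az.2, Function.update ω.2 k az.1) :=
      (measurable_updateSystem k).comp measurable_prodMk_left
    have hmu := fun i j => (hm i j).comp hu
    simp only [Function.comp_def, Function.update_self] at hmu
    simp_rw [hnorm, Function.update_self]
    rw [lintegral_const_mul _ ((Finset.measurable_sum _ fun i _ => Finset.measurable_sum _
        fun j _ => hmu i j).const_mul _),
      lintegral_const_mul _ (Finset.measurable_sum _ fun i _ => Finset.measurable_sum _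
        fun j _ => hmu i j),
      lintegral_finsetSum _ fun i _ => Finset.measurable_sum _ fun j _ => hmu i j,
      ← sum_sum_ite_eq_iff (hN (k + 1) le_rfl)]
    have hsum : ∀ i ∈ Finset.range (Np (k + 1)), _ := fun i hi =>
      (lintegral_finsetSum (μ := pfStep M G Np k (ω.1 k)) (Finset.range (Np (k + 1)))
        fun j _ => hmu i j).trans (Finset.sum_congr rfl fun j hj =>
          lintegral_pfStep_pairWeight_succ (hN k hk.le) (hG k hk) hF ω (Finset.mem_range.1 hi)
            (Finset.mem_range.1 hj))
    rw [Finset.sum_congr rfl hsum]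
    simp_rw [← Finset.sum_mul]
    have hweights : ENNReal.ofReal (etaN Np k (G k) ω) ^ 2 *
        ∑ a ∈ Finset.range (Np k), ∑ a' ∈ Finset.range (Np k),
          catWeight (Np k) (fun l => G k (ω.1 k l)) a *
            catWeight (Np k) (fun l => G k (ω.1 k l)) a' *
              (pairWeight G Np b k ω a a' *
                ∫⁻ q, F q ∂(pairKer M b (k + 1) (ω.1 k a, ω.1 k a'))) =
        (Np k : ℝ≥0∞)⁻¹ ^ 2 * ∑ i ∈ Finset.range (Np k), ∑ j ∈ Finset.range (Np k),
          pairWeight G Np b k ω i j * ((∫⁻ r, F r ∂(pairKer M b (k + 1) (ω.1 k i, ω.1 k j))) *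
            (ENNReal.ofReal (G k (ω.1 k i)) * ENNReal.ofReal (G k (ω.1 k j)))) := by
      simp_rw [Finset.mul_sum]
      refine Finset.sum_congr rfl fun a _ => Finset.sum_congr rfl fun a' _ => ?_
      have ha := ofReal_etaN_mul_catWeight (hN k hk.le) (hG k hk) ω a
      have ha' := ofReal_etaN_mul_catWeight (hN k hk.le) (hG k hk) ω a'
      calc _ = (ENNReal.ofReal (etaN Np k (G k) ω) *
              catWeight (Np k) (fun j => G k (ω.1 k j)) a) *
            (ENNReal.ofReal (etaN Np k (G k) ω) *
              catWeight (Np k) (fun j => G k (ω.1 k j)) a') *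
            (pairWeight G Np b k ω a a' *
              ∫⁻ q, F q ∂(pairKer M b (k + 1) (ω.1 k a, ω.1 k a'))) := by ring
        _ = _ := by rw [ha, ha']; ring
    rw [← hweights, normSq, Finset.prod_range_succ, ← normSq]
    ring

end ParticleSystem

section Tracing

variable {M0 : Measure X} {M : ℕ → Kernel X X} {G : ℕ → X → ℝ} {Np : ℕ → ℕ} {b : ℕ → Bool}

theorem trace_self (A : ℕ → ℕ → ℕ) (n i : ℕ) : trace A n i n = i := by
  simp [trace, traceAux]

theorem trace_of_lt (A : ℕ → ℕ → ℕ) {n q : ℕ} (hq : q < n) (i : ℕ) :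
    trace A n i q = A q (trace A n i (q + 1)) := by
  have h : n - q = (n - (q + 1)) + 1 := by omega
  have h' : n - (n - (q + 1) + 1) = q := by omega
  rw [trace, h, traceAux, h', trace]

theorem measurable_trace (n i : ℕ) :
    Measurable fun ω : (ℕ → ℕ → X) × (ℕ → ℕ → ℕ) => trace ω.2 n i := by
  have h : ∀ j, Measurable fun ω : (ℕ → ℕ → X) × (ℕ → ℕ → ℕ) => traceAux ω.2 n i j := by
    intro j
    induction j with
    | zero => exact measurable_const
    | succ j ih => exact measurable_comp_nat (fun l => measurable_ancestor _ l) ih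
  exact measurable_pi_lambda _ fun p => h _

theorem measurableSet_inI (n : ℕ) : MeasurableSet {k : (ℕ → ℕ) × (ℕ → ℕ) | inI Np n b k} := by
  simp only [inI, Set.ofPred_forall]
  refine MeasurableSet.iInter fun p => MeasurableSet.iInter fun _ => ?_
  have hm : Measurable fun k : (ℕ → ℕ) × (ℕ → ℕ) => (k.1 p, k.2 p) :=
    measurable_fst.eval.prodMk measurable_snd.eval
  exact hm (Set.to_countable
    {q : ℕ × ℕ | q.1 < Np p ∧ q.2 < Np p ∧ (q.1 = q.2 ↔ b p = true)}).measurableSet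

theorem measurable_ite_inI (n : ℕ) : Measurable fun k : (ℕ → ℕ) × (ℕ → ℕ) =>
    if inI Np n b k then (1 : ℝ≥0∞) else 0 :=
  Measurable.ite (measurableSet_inI n) measurable_const measurable_const

theorem inI_succ_update {p : ℕ} {K f : ℕ → ℕ} {v : ℕ} :
    inI Np (p + 1) b (K, Function.update f (p + 1) v) ↔
      (K (p + 1) < Np (p + 1) ∧ v < Np (p + 1) ∧ (K (p + 1) = v ↔ b (p + 1) = true)) ∧
        inI Np p b (K, f) := by
  constructor
  · intro h
    refine ⟨by simpa using h (p + 1) le_rfl, fun q hq => ?_⟩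
    simpa [Function.update_of_ne (Nat.lt_succ_of_le hq).ne] using h q (hq.trans p.le_succ)
  · rintro ⟨h1, h2⟩ q hq
    rcases Nat.le_succ_iff.1 hq with hq | rfl
    · simpa [Function.update_of_ne (Nat.lt_succ_of_le hq).ne] using h2 q hq
    · simpa using h1

theorem isProbabilityMeasure_k2Law {Y : Type*} {G : ℕ → Y → ℝ}
    {p : ℕ} (hN : ∀ q < p, 0 < Np q)
    (hG : ∀ q < p, ∀ x, 0 < G q x) (ω : (ℕ → ℕ → Y) × (ℕ → ℕ → ℕ)) (K : ℕ → ℕ) (v : ℕ) :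
    IsProbabilityMeasure (k2Law G Np ω K p v) := by
  induction p generalizing v with
  | zero => exact inferInstanceAs (IsProbabilityMeasure (Measure.dirac _))
  | succ p ih =>
    have ih' := ih (fun q hq => hN q (hq.trans p.lt_succ_self))
      fun q hq => hG q (hq.trans p.lt_succ_self)
    have hcat := isProbabilityMeasure_cat (hN p p.lt_succ_self) (w := fun j => G p (ω.1 p j))
      fun j => hG p p.lt_succ_self _
    have hmap : ∀ w, IsProbabilityMeasure
        ((k2Law G Np ω K p w).map fun f => Function.update f (p + 1) v) := fun w =>
      Measure.isProbabilityMeasure_map measurable_update_left.aemeasurable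
    simp only [k2Law]
    split_ifs
    · exact isProbabilityMeasure_bind (measurable_of_countable _)
    · exact isProbabilityMeasure_bind (measurable_of_countable _)

theorem measurable_k2Law {p : ℕ} (hN : ∀ q < p, 0 < Np q) (hG : ∀ q < p, ∀ x, 0 < G q x)
    (hGm : ∀ q < p, Measurable (G q)) (v : ℕ) :
    Measurable fun r : ((ℕ → ℕ → X) × (ℕ → ℕ → ℕ)) × (ℕ → ℕ) => k2Law G Np r.1 r.2 p v := by
  induction p generalizing v with
  | zero => exact measurable_const
  | succ p ih =>
    have hp := p.lt_succ_self
    have ih' := ih (fun q hq => hN q (hq.trans hp)) (fun q hq => hG q (hq.trans hp))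
      fun q hq => hGm q (hq.trans hp)
    have hcat := fun r : ((ℕ → ℕ → X) × (ℕ → ℕ → ℕ)) × (ℕ → ℕ) =>
      isProbabilityMeasure_cat (hN p hp) (w := fun j => G p (r.1.1 p j)) fun j => hG p hp _
    have hprob : ∀ r : ((ℕ → ℕ → X) × (ℕ → ℕ → ℕ)) × (ℕ → ℕ), IsProbabilityMeasure
        (if v = r.2 (p + 1) then cat (Np p) fun j => G p (r.1.1 p j)
          else Measure.dirac (r.1.2 p v)) := by
      intro r
      split_ifs
      · exact hcat r
      · infer_instance
    refine measurable_bind_family (μ := fun r : ((ℕ → ℕ → X) × (ℕ → ℕ → ℕ)) × (ℕ → ℕ) =>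
      if v = r.2 (p + 1) then cat (Np p) fun j => G p (r.1.1 p j)
        else Measure.dirac (r.1.2 p v)) ?_ ?_
    · refine Measurable.ite ?_ (measurable_cat _ fun j => (hGm p hp).comp
        ((measurable_particle p j).comp measurable_fst))
        (Measure.measurable_dirac.comp ((measurable_ancestor p v).comp measurable_fst))
      have hm : Measurable fun r : ((ℕ → ℕ → X) × (ℕ → ℕ → ℕ)) × (ℕ → ℕ) => r.2 (p + 1) :=
        measurable_snd.eval
      exact measurableSet_eq_fun measurable_const hm
    · refine measurable_from_prod_countable_left fun w => ?_
      exact (Measure.measurable_map _ measurable_update_left).comp (ih' w)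

theorem lintegral_k2Law {Y : Type*} {G : ℕ → Y → ℝ}
    {p : ℕ} (ω : (ℕ → ℕ → Y) × (ℕ → ℕ → ℕ)) {K : ℕ → ℕ}
    (hK : ∀ q < p, K q = ω.2 q (K (q + 1))) (g : ℕ → ℝ≥0∞) (v : ℕ) :
    ∫⁻ f, (if inI Np p b (K, f) then 1 else 0) * g (f p) ∂(k2Law G Np ω K p v) =
      pairWeight G Np b p ω (K p) v * g v := by
  have hm : ∀ (p : ℕ) (g : ℕ → ℝ≥0∞),
      Measurable fun f : ℕ → ℕ => (if inI Np p b (K, f) then 1 else 0) * g (f p) := fun p g =>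
    ((measurable_ite_inI p).comp measurable_prodMk_left).mul
      ((measurable_of_countable g).comp (measurable_pi_apply p))
  induction p generalizing v g with
  | zero =>
    rw [k2Law, lintegral_dirac' _ (hm 0 g)]
    simp [inI, pairWeight]
  | succ p ih =>
    have ih' := fun w => ih (fun q hq => hK q (hq.trans p.lt_succ_self)) (fun _ => 1) w
    simp only [mul_one] at ih'
    rw [k2Law, Measure.lintegral_bind (measurable_of_countable _).aemeasurable
      (hm (p + 1) g).aemeasurable]
    have hstep : ∀ w, ∫⁻ f, (if inI Np (p + 1) b (K, f) then 1 else 0) * g (f (p + 1))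
        ∂((k2Law G Np ω K p w).map fun f => Function.update f (p + 1) v) =
          (if K (p + 1) < Np (p + 1) ∧ v < Np (p + 1) ∧ (K (p + 1) = v ↔ b (p + 1) = true)
            then pairWeight G Np b p ω (K p) w else 0) * g v := by
      intro w
      rw [lintegral_map (hm (p + 1) g) measurable_update_left, ← ih']
      simp only [inI_succ_update, Function.update_self]
      have hm1 := hm p fun _ => 1
      simp only [mul_one] at hm1
      rw [lintegral_mul_const _ (by
        simp only [ite_and]
        split_ifs <;> first | exact hm1 | exact measurable_const)]
      split_ifs with h
      · simp [h]
      · simp [h]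
    simp_rw [hstep]
    simp only [pairWeight, ← hK p p.lt_succ_self]
    by_cases h : K (p + 1) < Np (p + 1) ∧ v < Np (p + 1) ∧ (K (p + 1) = v ↔ b (p + 1) = true)
    · simp only [if_pos h]
      by_cases hv : v = K (p + 1)
      · simp only [if_pos hv, lintegral_cat, Finset.sum_mul, mul_assoc]
      · simp only [if_neg hv, lintegral_dirac]
    · simp only [if_neg h, zero_mul, lintegral_zero]

theorem catWeight_one (m j : ℕ) : catWeight m (fun _ => 1) j = (m : ℝ≥0∞)⁻¹ := by
  simp [catWeight]

theorem isProbabilityMeasure_kLaw {Y : Type*} {G : ℕ → Y → ℝ} {n : ℕ} (hN : ∀ q ≤ n, 0 < Np q)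
    (hG : ∀ q < n, ∀ x, 0 < G q x) (ω : (ℕ → ℕ → Y) × (ℕ → ℕ → ℕ)) :
    IsProbabilityMeasure (kLaw G Np n ω) := by
  have hu : IsProbabilityMeasure (unif (Np n)) :=
    isProbabilityMeasure_cat (hN n le_rfl) fun _ => one_pos
  have hk := isProbabilityMeasure_k2Law (fun q hq => hN q hq.le) hG ω
  have h2 : ∀ i, IsProbabilityMeasure ((unif (Np n)).bind fun k2n =>
      (k2Law G Np ω (trace ω.2 n i) n k2n).map fun k2 => (trace ω.2 n i, k2)) := by
    intro i
    have : ∀ j, IsProbabilityMeasure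
        ((k2Law G Np ω (trace ω.2 n i) n j).map fun k2 => (trace ω.2 n i, k2)) := fun j =>
      Measure.isProbabilityMeasure_map measurable_prodMk_left.aemeasurable
    exact isProbabilityMeasure_bind (measurable_of_countable _)
  exact isProbabilityMeasure_bind (measurable_of_countable _)

theorem measurable_kLaw {n : ℕ} (hN : ∀ q ≤ n, 0 < Np q) (hG : ∀ q < n, ∀ x, 0 < G q x)
    (hGm : ∀ q < n, Measurable (G q)) : Measurable (kLaw G Np n) := by
  have hu : IsProbabilityMeasure (unif (Np n)) :=
    isProbabilityMeasure_cat (hN n le_rfl) fun _ => one_pos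
  have hk := fun (i j : ℕ) (ω : (ℕ → ℕ → X) × (ℕ → ℕ → ℕ)) =>
    isProbabilityMeasure_k2Law (fun q hq => hN q hq.le) hG ω (trace ω.2 n i) j
  refine measurable_bind_family (μ := fun _ => unif (Np n)) measurable_const
    (measurable_from_prod_countable_left fun i => ?_)
  refine measurable_bind_family (μ := fun _ => unif (Np n)) measurable_const
    (measurable_from_prod_countable_left fun j => ?_)
  have := hk i j
  exact measurable_map_family
    (μ := fun ω : (ℕ → ℕ → X) × (ℕ → ℕ → ℕ) => k2Law G Np ω (trace ω.2 n i) n j)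
    (f := fun ω k2 => (trace ω.2 n i, k2))
    ((measurable_k2Law (fun q hq => hN q hq.le) hG hGm j).comp
      (measurable_id.prodMk (measurable_trace n i)))
    (((measurable_trace n i).comp measurable_fst).prodMk measurable_snd)

theorem lintegral_kLaw {Y : Type*} {G : ℕ → Y → ℝ} {n : ℕ}
    (ω : (ℕ → ℕ → Y) × (ℕ → ℕ → ℕ)) (g : ℕ → ℕ → ℝ≥0∞) :
    ∫⁻ k, (if inI Np n b k then 1 else 0) * g (k.1 n) (k.2 n) ∂(kLaw G Np n ω) =
      (Np n : ℝ≥0∞)⁻¹ ^ 2 * ∑ i ∈ Finset.range (Np n), ∑ j ∈ Finset.range (Np n),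
        pairWeight G Np b n ω i j * g i j := by
  have hm : Measurable fun k : (ℕ → ℕ) × (ℕ → ℕ) =>
      (if inI Np n b k then 1 else 0) * g (k.1 n) (k.2 n) :=
    (measurable_ite_inI n).mul <| show Measurable ((fun q : ℕ × ℕ => g q.1 q.2) ∘
      fun k : (ℕ → ℕ) × (ℕ → ℕ) => (k.1 n, k.2 n)) from
    (measurable_of_countable _).comp (measurable_fst.eval.prodMk measurable_snd.eval)
  rw [kLaw, Measure.lintegral_bind (measurable_of_countable _).aemeasurable hm.aemeasurable, unif,
    lintegral_cat, Finset.mul_sum]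
  refine Finset.sum_congr rfl fun i _ => ?_
  rw [Measure.lintegral_bind (measurable_of_countable _).aemeasurable hm.aemeasurable,
    lintegral_cat, catWeight_one, sq, mul_assoc]
  congr 1
  rw [Finset.mul_sum]
  refine Finset.sum_congr rfl fun j _ => ?_
  rw [lintegral_map hm measurable_prodMk_left, catWeight_one]
  simp only [trace_self]
  rw [lintegral_k2Law ω (fun q hq => trace_of_lt ω.2 hq i) (g i) j, trace_self]

end Tracing

section Moment

variable {M0 : Measure X} {M : ℕ → Kernel X X} {G : ℕ → X → ℝ} {Np : ℕ → ℕ} {b : ℕ → Bool}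

theorem lintegral_pfkLaw [Nonempty X] {n : ℕ} (hN : ∀ q ≤ n, 0 < Np q)
    (hG : ∀ q < n, ∀ x, 0 < G q x)
    (hGm : ∀ q < n, Measurable (G q))
    {H : ((ℕ → ℕ → X) × (ℕ → ℕ → ℕ)) × ((ℕ → ℕ) × (ℕ → ℕ)) → ℝ≥0∞} (hH : Measurable H) :
    ∫⁻ r, H r ∂(pfkLaw M0 M G Np n) =
      ∫⁻ ω, ∫⁻ k, H (ω, k) ∂(kLaw G Np n ω) ∂(pfLaw M0 M G Np n) := by
  have hk := isProbabilityMeasure_kLaw hN hG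
  rw [pfkLaw, Measure.lintegral_bind (measurable_map_family (μ := kLaw G Np n)
    (f := fun ω k => (ω, k)) (measurable_kLaw hN hG hGm) measurable_id).aemeasurable
    hH.aemeasurable]
  simp_rw [lintegral_map hH measurable_prodMk_left]

theorem measurable_tracedPair (n : ℕ) :
    Measurable fun r : ((ℕ → ℕ → X) × (ℕ → ℕ → ℕ)) × ((ℕ → ℕ) × (ℕ → ℕ)) =>
      (r.1.1 n (r.2.1 n), r.1.1 n (r.2.2 n)) := by
  have hp : ∀ j, Measurable
      fun r : ((ℕ → ℕ → X) × (ℕ → ℕ → ℕ)) × ((ℕ → ℕ) × (ℕ → ℕ)) => r.1.1 n j := fun j =>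
    (measurable_particle n j).comp measurable_fst
  exact (measurable_comp_nat hp measurable_snd.fst.eval).prodMk
    (measurable_comp_nat hp measurable_snd.snd.eval)

/-- The weight `1{(K¹, K²) ∈ I(b)} γ_n^N(1)²`. -/
def tracingDensity (G : ℕ → X → ℝ) (Np : ℕ → ℕ) (n : ℕ) (b : ℕ → Bool)
    (r : ((ℕ → ℕ → X) × (ℕ → ℕ → ℕ)) × ((ℕ → ℕ) × (ℕ → ℕ))) : ℝ≥0∞ :=
  (if inI Np n b r.2 then 1 else 0) * normSq G Np n r.1

theorem measurable_tracingDensity {n : ℕ} (hGm : ∀ q < n, Measurable (G q)) :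
    Measurable (tracingDensity G Np n b) :=
  ((measurable_ite_inI n).comp measurable_snd).mul ((measurable_normSq hGm).comp measurable_fst)

theorem toReal_normSq {Y : Type*} {G : ℕ → Y → ℝ}
    {n : ℕ} (hN : 0 < Np n) (hG : ∀ q < n, ∀ x, 0 < G q x)
    (ω : (ℕ → ℕ → Y) × (ℕ → ℕ → ℕ)) :
    (normSq G Np n ω).toReal = gammaN G Np n 1 ω ^ 2 := by
  have h1 : etaN Np n (1 : Y → ℝ) ω = 1 := by
    have : (Np n : ℝ) ≠ 0 := by positivity
    simp [etaN, this]
  rw [normSq, gammaN, h1, mul_one, ENNReal.toReal_prod, ← Finset.prod_pow]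
  refine Finset.prod_congr rfl fun q hq => ?_
  rw [ENNReal.toReal_pow, ENNReal.toReal_ofReal]
  exact mul_nonneg (by positivity)
    (Finset.sum_nonneg fun i _ => (hG q (Finset.mem_range.1 hq) _).le)

theorem toReal_pathPotential {Y : Type*} {G : ℕ → Y → ℝ}
    {n : ℕ} (hG : ∀ q < n, ∀ x, 0 < G q x) (ω : ℕ → Y × Y) :
    (pathPotential G n ω).toReal = ∏ p ∈ Finset.range n, G p (ω p).1 * G p (ω p).2 := by
  rw [pathPotential, ENNReal.toReal_prod]
  refine Finset.prod_congr rfl fun q hq => ?_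
  have h := hG q (Finset.mem_range.1 hq)
  rw [ENNReal.toReal_mul, ENNReal.toReal_ofReal (h _).le, ENNReal.toReal_ofReal (h _).le]

theorem toReal_coincidence_prod {n : ℕ} (hN : ∀ q ≤ n, 0 < Np q) :
    (∏ p ∈ Finset.range (n + 1),
        if b p then (Np p : ℝ≥0∞)⁻¹ else 1 - (Np p : ℝ≥0∞)⁻¹).toReal =
      ∏ p ∈ Finset.range (n + 1), if b p then (Np p : ℝ)⁻¹ else 1 - (Np p : ℝ)⁻¹ := by
  rw [ENNReal.toReal_prod]
  refine Finset.prod_congr rfl fun q hq => ?_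
  have h : (Np q : ℝ≥0∞)⁻¹ ≤ 1 :=
    ENNReal.inv_le_one.2 (Nat.one_le_cast.2 (hN q (Nat.lt_succ_iff.1 (Finset.mem_range.1 hq))))
  split_ifs
  · simp
  · rw [ENNReal.toReal_sub_of_le h ENNReal.one_ne_top]
    simp

variable [Nonempty X] [IsProbabilityMeasure M0] [∀ p, IsMarkovKernel (M p)]

theorem lintegral_tracingDensity_mul {n : ℕ} (hN : ∀ q ≤ n, 0 < Np q)
    (hG : ∀ q < n, ∀ x, 0 < G q x) (hGm : ∀ q < n, Measurable (G q))
    {F : X × X → ℝ≥0∞} (hF : Measurable F) :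
    ∫⁻ r, tracingDensity G Np n b r * F (r.1.1 n (r.2.1 n), r.1.1 n (r.2.2 n))
        ∂(pfkLaw M0 M G Np n) =
      (∏ p ∈ Finset.range (n + 1),
        if b p then (Np p : ℝ≥0∞)⁻¹ else 1 - (Np p : ℝ≥0∞)⁻¹) *
        ∫⁻ ω, F (ω n) * pathPotential G n ω
          ∂(markovPath (pairInit M0 b) (pairKer M b) n) := by
  have hH : Measurable fun r : ((ℕ → ℕ → X) × (ℕ → ℕ → ℕ)) × ((ℕ → ℕ) × (ℕ → ℕ)) =>
      tracingDensity G Np n b r * F (r.1.1 n (r.2.1 n), r.1.1 n (r.2.2 n)) :=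
    (measurable_tracingDensity hGm).mul (hF.comp (measurable_tracedPair n))
  rw [lintegral_pfkLaw hN hG hGm hH, ← lintegral_pfLaw_pairWeight hN hG hGm hF]
  refine lintegral_congr fun ω => ?_
  rw [← lintegral_kLaw ω fun i j => F (ω.1 n i, ω.1 n j), ← lintegral_const_mul]
  · refine lintegral_congr fun k => ?_
    simp only [tracingDensity]
    ring
  · exact (measurable_ite_inI n).mul
      ((hF.comp (measurable_tracedPair n)).comp measurable_prodMk_left)

theorem map_withDensity_pfkLaw {n : ℕ} (hN : ∀ q ≤ n, 0 < Np q)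
    (hG : ∀ q < n, ∀ x, 0 < G q x) (hGm : ∀ q < n, Measurable (G q)) :
    ((pfkLaw M0 M G Np n).withDensity (tracingDensity G Np n b)).map
        (fun r => (r.1.1 n (r.2.1 n), r.1.1 n (r.2.2 n))) =
      (∏ p ∈ Finset.range (n + 1),
        if b p then (Np p : ℝ≥0∞)⁻¹ else 1 - (Np p : ℝ≥0∞)⁻¹) •
        ((markovPath (pairInit M0 b) (pairKer M b) n).withDensity
          (pathPotential G n)).map fun ω => ω n := by
  ext s hs
  have hF : Measurable (s.indicator (1 : X × X → ℝ≥0∞)) := measurable_one.indicator hs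
  have hn : Measurable fun ω : ℕ → X × X => ω n := measurable_pi_apply n
  have hF₁ : Measurable fun r : ((ℕ → ℕ → X) × (ℕ → ℕ → ℕ)) × ((ℕ → ℕ) × (ℕ → ℕ)) =>
      s.indicator (1 : X × X → ℝ≥0∞) (r.1.1 n (r.2.1 n), r.1.1 n (r.2.2 n)) :=
    hF.comp (measurable_tracedPair n)
  have hF₂ : Measurable fun ω : ℕ → X × X => s.indicator (1 : X × X → ℝ≥0∞) (ω n) := hF.comp hn
  rw [Measure.smul_apply, ← lintegral_indicator_one hs, ← lintegral_indicator_one hs,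
    lintegral_map hF (measurable_tracedPair n), lintegral_map hF hn,
    lintegral_withDensity_eq_lintegral_mul _ (measurable_tracingDensity hGm) hF₁,
    lintegral_withDensity_eq_lintegral_mul _ (measurable_pathPotential hGm) hF₂,
    smul_eq_mul]
  simpa only [Pi.mul_apply, Function.comp_apply, mul_comm (pathPotential G n _)] using
    lintegral_tracingDensity_mul (M0 := M0) (M := M) (b := b) hN hG hGm hF

theorem integral_pfkLaw_eq_muB {n : ℕ} (hN : ∀ q ≤ n, 0 < Np q)
    (hG : ∀ q < n, ∀ x, 0 < G q x) (hGm : ∀ q < n, Measurable (G q))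
    {φ : X × X → ℝ} (hφ : Measurable φ) :
    ∫ r, (if inI Np n b r.2 then (1 : ℝ) else 0) *
        (gammaN G Np n (1 : X → ℝ) r.1 ^ 2 * φ (r.1.1 n (r.2.1 n), r.1.1 n (r.2.2 n)))
        ∂(pfkLaw M0 M G Np n) =
      (∏ p ∈ Finset.range (n + 1), if b p then (Np p : ℝ)⁻¹ else 1 - (Np p : ℝ)⁻¹) *
        muB M0 M G n b φ := by
  have hn : Measurable fun ω : ℕ → X × X => ω n := measurable_pi_apply n
  have hD : ∀ r, tracingDensity G Np n b r < ∞ := fun r => by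
    refine ENNReal.mul_lt_top (by split_ifs <;> simp) (ENNReal.prod_lt_top fun q _ => ?_)
    exact ENNReal.pow_lt_top ENNReal.ofReal_lt_top
  have hP : ∀ ω : ℕ → X × X, pathPotential G n ω < ∞ := fun ω =>
    ENNReal.prod_lt_top fun q _ => ENNReal.mul_lt_top ENNReal.ofReal_lt_top ENNReal.ofReal_lt_top
  have h := congrArg (fun ν => ∫ q, φ q ∂ν)
    (map_withDensity_pfkLaw (M0 := M0) (M := M) (b := b) hN hG hGm)
  simp only [integral_smul_measure] at h
  rw [integral_map (measurable_tracedPair n).aemeasurable hφ.aestronglyMeasurable,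
    integral_map hn.aemeasurable hφ.aestronglyMeasurable,
    integral_withDensity_eq_integral_toReal_smul (measurable_tracingDensity hGm)
      (Eventually.of_forall hD),
    integral_withDensity_eq_integral_toReal_smul (measurable_pathPotential hGm)
      (Eventually.of_forall hP), toReal_coincidence_prod hN, smul_eq_mul] at h
  simp only [muB, ← toReal_pathPotential hG, ← toReal_normSq (hN n le_rfl) hG]
  simp only [smul_eq_mul, mul_comm (ENNReal.toReal (pathPotential G n _))] at h
  rw [← h]
  refine integral_congr_ae (Eventually.of_forall fun r => ?_)
  simp only [tracingDensity, ENNReal.toReal_mul]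
  split_ifs <;> simp

end Moment

theorem statement6
    {X : Type*} [MeasurableSpace X] [Nonempty X] (hX : ∃ x y : X, x ≠ y) (n : ℕ)
    (M0 : Measure X) [IsProbabilityMeasure M0]
    (M : ℕ → Kernel X X) [∀ p, IsMarkovKernel (M p)]
    (G : ℕ → X → ℝ) (hGm : ∀ p ≤ n, Measurable (G p))
    (hGpos : ∀ p ≤ n, ∀ x, 0 < G p x) (hGbd : ∀ p ≤ n, ∃ C, ∀ x, G p x ≤ C)
    (c : ℕ → ℝ) (hc : ∀ p ≤ n, 0 < c p)
    (b : Fin (n + 1) → Bool)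
    (φ : X × X → ℝ) (hφm : Measurable φ) (hφb : ∃ C, ∀ q, |φ q| ≤ C) :
    ∀ N : ℕ, 1 ≤ N → (∀ p ≤ n, 2 ≤ npart c N p) →
      ∫ ωk, (if inI (npart c N) n (extB n b) ωk.2 then (1 : ℝ) else 0) *
          (gammaN G (npart c N) n (1 : X → ℝ) ωk.1 ^ 2 *
            φ (ωk.1.1 n (ωk.2.1 n), ωk.1.1 n (ωk.2.2 n)))
          ∂(pfkLaw M0 M G (npart c N) n)
        = (∏ p ∈ Finset.range (n + 1),
              if extB n b p then ((npart c N p : ℝ))⁻¹ else 1 - ((npart c N p : ℝ))⁻¹) *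
            muB M0 M G n (extB n b) φ := by
  intro N _ hNp
  exact integral_pfkLaw_eq_muB (fun q hq => two_pos.trans_le (hNp q hq))
    (fun q hq => hGpos q hq.le) (fun q hq => hGm q hq.le) hφm
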